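/- arXiv:1411.4990 — 10 statements merged into one kernel-verified Lean document; each statement's English description precedes it below -/
import Mathlib

section
/- Let f be a polynomial with rational coefficients of degree n that is irreducible over ℚ. Suppose f is 1-solvable, i.e. there exist a real number R and a positive integer D with R^D ∈ ℚ such that f has a root lying in ℚ[R]. Then there exist a polynomial A with rational coefficients and a real number r with r^n ∈ ℚ such that A(r) is a root of f. -/
/-- A real number is "rational" if it is in the range of the cast `ℚ → ℝ`. -/
def IsRat (x : ℝ) : Prop := x ∈ Set.range ((↑) : ℚ → ℝ)

open Polynomial IntermediateField in
/-- If a power of a real number `R` lies in a subfield `F`, then so does the power whose exponent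
is the degree of `R` over `F`. -/
theorem pow_natDegree_minpoly_mem_range {F : Type*} [Field F] [Algebra F ℝ] {R : ℝ} {D : ℕ}
    (hD : 0 < D) {a : F} (ha : R ^ D = algebraMap F ℝ a) :
    R ^ (minpoly F R).natDegree ∈ Set.range (algebraMap F ℝ) := by
  have hroot : aeval R (X ^ D - C a) = 0 := by simp [ha]
  have hint : IsIntegral F R := ⟨X ^ D - C a, monic_X_pow_sub_C a hD.ne', by simpa using hroot⟩
  obtain ⟨q, hq⟩ := minpoly.dvd F R hroot
  set p := minpoly F R with hp
  set φ : F →+* ℂ := Complex.ofRealHom.comp (algebraMap F ℝ) with hφ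
  have hroots : ∀ z ∈ (p.map φ).roots, ‖z‖ = |R| := by
    intro z hz
    have hz0 : eval₂ φ z p = 0 := by
      rw [← eval_map]
      exact isRoot_of_mem_roots hz
    have h1 : eval₂ φ z (X ^ D - C a) = 0 := by rw [hq, eval₂_mul, hz0, zero_mul]
    have h2 : z ^ D = ((R ^ D : ℝ) : ℂ) := by
      rw [ha]
      simpa [hφ, sub_eq_zero] using h1
    have h3 : ‖z‖ ^ D = |R| ^ D := by
      rw [← norm_pow, h2, Complex.norm_real, Real.norm_eq_abs, abs_pow]
    exact (pow_left_inj₀ (norm_nonneg _) (abs_nonneg _) hD.ne').1 h3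
  have hsplit : (p.map φ).Splits := IsAlgClosed.splits _
  have hmonic : (p.map φ).Monic := (minpoly.monic hint).map φ
  have hcard : (p.map φ).roots.card = p.natDegree := by
    rw [← hsplit.natDegree_eq_card_roots, natDegree_map]
  have hprod : ‖(p.map φ).roots.prod‖ = |R| ^ p.natDegree := by
    rw [← hcard, ← Multiset.prod_replicate, ← Multiset.map_const', ← Multiset.map_congr rfl hroots]
    exact map_multiset_prod (normHom : ℂ →*₀ ℝ) _
  have hcoeff : |algebraMap F ℝ (p.coeff 0)| = |R ^ p.natDegree| := by
    have h := hsplit.coeff_zero_eq_prod_roots_of_monic hmonic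
    have h' := congrArg norm h
    rw [norm_mul, hprod, norm_pow, norm_neg, norm_one, one_pow, one_mul, coeff_map] at h'
    rw [abs_pow, ← h', hφ]
    simp
  rcases abs_eq_abs.1 hcoeff with h | h
  · exact ⟨_, h⟩
  · exact ⟨-p.coeff 0, by rw [map_neg, h, neg_neg]⟩

open IntermediateField in
theorem IntermediateField.natDegree_minpoly_mul_of_mem_adjoin {F E : Type*} [Field F] [Field E]
    [Algebra F E] {R y : E} (hR : IsIntegral F R) (hy : y ∈ F⟮R⟯) :
    Module.finrank F F⟮y⟯ * (minpoly F⟮y⟯ R).natDegree = (minpoly F R).natDegree := by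
  have hle : (F⟮y⟯⟮R⟯).restrictScalars F = F⟮R⟯ := by
    rw [adjoin_adjoin_left]
    apply le_antisymm
    · rw [adjoin_le_iff]
      rintro z (rfl | rfl)
      · exact hy
      · exact mem_adjoin_simple_self F z
    · exact adjoin.mono F _ _ Set.subset_union_right
  rw [← adjoin.finrank hR, ← adjoin.finrank (hR.tower_top (A := F⟮y⟯)), ← hle]
  exact Module.finrank_mul_finrank F F⟮y⟯ F⟮y⟯⟮R⟯

open Polynomial IntermediateField in
/-- If a polynomial `f` over `ℚ` of degree `n` is irreducible and 1-solvable
(i.e. it has a real root lying in `ℚ[R]` for some real `R` with `R ^ D` rational for some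
positive integer `D`), then `f` has a root of the form `A(r)` where `A` is a polynomial
with rational coefficients and `r` is a real number with `r ^ n` rational. -/
theorem stmt_0 (f : Polynomial ℚ) (n : ℕ) (hdeg : f.natDegree = n)
    (hirr : Irreducible f)
    (hsolv : ∃ (R : ℝ) (D : ℕ), 0 < D ∧ IsRat (R ^ D) ∧
      ∃ x : ℝ, x ∈ Algebra.adjoin ℚ ({R} : Set ℝ) ∧ Polynomial.aeval x f = 0) :
    ∃ (A : Polynomial ℚ) (r : ℝ), IsRat (r ^ n) ∧
      Polynomial.aeval (Polynomial.aeval r A) f = 0 := by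
  obtain ⟨R, D, hD, ⟨a, ha⟩, x, hxR, hfx⟩ := hsolv
  have hR : IsIntegral ℚ R :=
    IsIntegral.of_pow hD (ha ▸ isIntegral_algebraMap (R := ℚ) (A := ℝ) (x := a))
  have hx : x ∈ ℚ⟮R⟯ := algebra_adjoin_le_adjoin ℚ _ hxR
  have hxint : IsIntegral ℚ x := IsAlgebraic.isIntegral ⟨f, hirr.ne_zero, hfx⟩
  have hn : Module.finrank ℚ ℚ⟮x⟯ = n := by
    rw [adjoin.finrank hxint, ← hdeg, ← minpoly.eq_of_irreducible hirr hfx,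
      natDegree_mul_C (inv_ne_zero (leadingCoeff_ne_zero.2 hirr.ne_zero))]
  set d := (minpoly ℚ⟮x⟯ R).natDegree with hd
  have hdn : n * d = (minpoly ℚ R).natDegree := by
    rw [← hn]
    exact natDegree_minpoly_mul_of_mem_adjoin hR hx
  have hd0 : 0 < d := minpoly.natDegree_pos hR.tower_top
  have hrat : IsRat ((R ^ d) ^ n) := by
    rw [← pow_mul, mul_comm, hdn]
    exact pow_natDegree_minpoly_mem_range hD (a := a) ha.symm
  have hrx : R ^ d ∈ ℚ⟮x⟯ := by
    obtain ⟨b, hb⟩ := pow_natDegree_minpoly_mem_range (F := ℚ⟮x⟯) (R := R) hD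
      (a := algebraMap ℚ ℚ⟮x⟯ a) ha.symm
    rw [← hb]
    exact b.2
  have hrR : R ^ d ∈ ℚ⟮R⟯ := pow_mem (mem_adjoin_simple_self ℚ R) d
  have hmul := natDegree_minpoly_mul_of_mem_adjoin hR hrR
  have hle : (minpoly ℚ⟮R ^ d⟯ R).natDegree ≤ d := by
    have hmon := monic_X_pow_sub_C (AdjoinSimple.gen ℚ (R ^ d)) hd0.ne'
    refine (natDegree_le_of_dvd (minpoly.dvd _ R ?_) hmon.ne_zero).trans_eq natDegree_X_pow_sub_C
    simp
  have hfin : Module.finrank ℚ ℚ⟮x⟯ ≤ Module.finrank ℚ ℚ⟮R ^ d⟯ := by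
    rw [hn]
    refine Nat.le_of_mul_le_mul_right ?_ hd0
    rw [hdn, ← hmul]
    exact Nat.mul_le_mul_left _ hle
  have : FiniteDimensional ℚ ℚ⟮x⟯ := adjoin.finiteDimensional hxint
  have heq : ℚ⟮R ^ d⟯ = ℚ⟮x⟯ := eq_of_le_of_finrank_le (adjoin_simple_le_iff.2 hrx) hfin
  have hxr : x ∈ Algebra.adjoin ℚ {R ^ d} := by
    rw [← adjoin_simple_toSubalgebra_of_isAlgebraic (hR.pow d).isAlgebraic, heq]
    exact mem_adjoin_simple_self ℚ x
  rw [Algebra.adjoin_singleton_eq_range_aeval] at hxr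
  obtain ⟨A, hA⟩ := hxr
  exact ⟨A, R ^ d, hrat, by rw [← hfx, ← hA]; rfl⟩
end

section
/- For rational numbers p, q, set D_{pq} = (p/3)^3 + (q/2)^2. The following three conditions on the polynomial x^3 + p x + q are equivalent: (i) it is 1-solvable, i.e. it has a root x ∈ ℚ[r] for some real r with r^n ∈ ℚ for some positive integer n; (ii) it has a root of the form a + b r + c r^2 where r ∈ ℝ and a, b, c, r^3 ∈ ℚ; (iii) either it has a rational root, or D_{pq} ≥ 0 and √(D_{pq}) ∈ ℚ. -/
open Polynomial IntermediateField in
/-- If a power of a real number `r` lies in a subfield `K` of `ℝ`, then so does `r ^ [K(r) : K]`: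
up to sign it is the norm of `r`. -/
theorem pow_natDegree_minpoly_mem_range_s1 {K : Type*} [Field K] [Algebra K ℝ] {r : ℝ} {n : ℕ}
    (hn : 0 < n) (h : r ^ n ∈ Set.range (algebraMap K ℝ)) :
    r ^ (minpoly K r).natDegree ∈ Set.range (algebraMap K ℝ) := by
  obtain ⟨k, hk⟩ := h
  have hroot : aeval r (X ^ n - C k : K[X]) = 0 := by simp [hk]
  have hint : IsIntegral K r := ⟨X ^ n - C k, monic_X_pow_sub_C k hn.ne', by
    simpa [aeval_def] using hroot⟩
  have hdvd := minpoly.dvd K r hroot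
  let φ : K →+* ℂ := Complex.ofRealHom.comp (algebraMap K ℝ)
  let P := (minpoly K r).map φ
  have hP : P.Monic := (minpoly.monic hint).map φ
  have hsplit : P.Splits := IsAlgClosed.splits P
  have hnorm : ∀ z ∈ P.roots, ‖z‖ = |r| := by
    intro z hz
    have hz0 : P.eval z = 0 := (mem_roots'.1 hz).2
    have h1 : ((X ^ n - C k : K[X]).map φ).eval z = 0 :=
      eval_eq_zero_of_dvd_of_eval_eq_zero (Polynomial.map_dvd φ hdvd) hz0
    have h2 : z ^ n = (r : ℂ) ^ n := by
      simp only [Polynomial.map_sub, Polynomial.map_pow, map_X, map_C, eval_sub, eval_pow, eval_X,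
        eval_C, sub_eq_zero] at h1
      rw [h1]
      simp [φ, hk]
    have h3 : ‖z‖ ^ n = |r| ^ n := by
      rw [← norm_pow, h2, norm_pow, Complex.norm_real, Real.norm_eq_abs]
    exact (pow_left_inj₀ (norm_nonneg _) (abs_nonneg _) hn.ne').1 h3
  have hprod : ‖P.coeff 0‖ = |r| ^ P.natDegree := by
    rw [hsplit.coeff_zero_eq_prod_roots_of_monic hP, norm_mul, norm_pow, norm_neg, norm_one,
      one_pow, one_mul, hsplit.natDegree_eq_card_roots]
    have : (P.roots.map (fun z => ‖z‖)).prod = |r| ^ P.roots.card := by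
      rw [Multiset.map_congr rfl hnorm]
      simp
    rw [← this]
    exact map_multiset_prod (normHom : ℂ →*₀ ℝ) P.roots
  have habs : |algebraMap K ℝ ((minpoly K r).coeff 0)| = |r ^ (minpoly K r).natDegree| := by
    rw [abs_pow, ← (minpoly.monic hint).natDegree_map φ, ← hprod, coeff_map]
    simp [φ]
  rcases abs_eq_abs.1 habs with h | h
  · exact ⟨_, h⟩
  · exact ⟨-(minpoly K r).coeff 0, by rw [map_neg, h, neg_neg]⟩

/-- Elements of `ℚ[s]` with `s ^ 3 = k` are quadratic polynomials in `s`. -/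
theorem exists_quadratic_of_mem_adjoin {s x : ℝ} {k : ℚ} (hs : s ^ 3 = k)
    (hx : x ∈ Algebra.adjoin ℚ ({s} : Set ℝ)) :
    ∃ a b c : ℚ, x = a + b * s + c * s ^ 2 := by
  induction hx using Algebra.adjoin_induction with
  | mem y hy => exact ⟨0, 1, 0, by rw [Set.mem_singleton_iff.1 hy]; simp⟩
  | algebraMap y => exact ⟨y, 0, 0, by simp⟩
  | add y z _ _ hy hz =>
    obtain ⟨a, b, c, rfl⟩ := hy
    obtain ⟨a', b', c', rfl⟩ := hz
    exact ⟨a + a', b + b', c + c', by push_cast; ring⟩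
  | mul y z _ _ hy hz =>
    obtain ⟨a, b, c, rfl⟩ := hy
    obtain ⟨a', b', c', rfl⟩ := hz
    refine ⟨a * a' + k * (b * c' + c * b'), a * b' + b * a' + k * c * c',
      a * c' + b * b' + c * a', ?_⟩
    push_cast
    linear_combination (b * c' + c * b' + c * c' * s) * hs

open Polynomial in
/-- A real root of a depressed rational cubic without rational roots has degree three. -/
theorem natDegree_minpoly_eq_three {p q : ℚ} (hno : ¬ ∃ x : ℚ, x ^ 3 + p * x + q = 0) {x : ℝ}
    (hx : x ^ 3 + p * x + q = 0) :
    IsIntegral ℚ x ∧ (minpoly ℚ x).natDegree = 3 := by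
  let f : ℚ[X] := X ^ 3 + C p * X + C q
  have hdeg : f.natDegree = 3 := by unfold f; compute_degree!
  have hmonic : f.Monic := by unfold f; monicity!
  have hirr : Irreducible f := by
    rw [irreducible_iff_roots_eq_zero_of_degree_le_three (by omega) (by omega)]
    refine Multiset.eq_zero_of_forall_notMem fun z hz => hno ⟨z, ?_⟩
    simpa [f] using (mem_roots'.1 hz).2
  have hroot : aeval x f = 0 := by simpa [f] using hx
  refine ⟨⟨f, hmonic, hroot⟩, ?_⟩
  rw [← minpoly.eq_of_irreducible_of_monic hirr hroot hmonic, hdeg]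

open IntermediateField in
theorem natDegree_minpoly_eq_mul {F E : Type*} [Field F] [Field E] [Algebra F E] {x r : E}
    (hr : IsIntegral F r) (hx : x ∈ F⟮r⟯) :
    (minpoly F r).natDegree = (minpoly F x).natDegree * (minpoly F⟮x⟯ r).natDegree := by
  have hxint : IsIntegral F x := by
    have : FiniteDimensional F F⟮r⟯ := adjoin.finiteDimensional hr
    exact (isIntegral_iff (x := (⟨x, hx⟩ : F⟮r⟯))).1 (IsIntegral.of_finite F _)
  have h : (F⟮x⟯⟮r⟯).restrictScalars F = F⟮r⟯ := by
    rw [adjoin_simple_adjoin_simple]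
    apply le_antisymm
    · rw [adjoin_le_iff]
      rintro y (rfl | rfl)
      · exact hx
      · exact mem_adjoin_simple_self F _
    · exact adjoin.mono F _ _ (by simp)
  rw [← adjoin.finrank hr, ← h, ← adjoin.finrank hr.tower_top, ← adjoin.finrank hxint]
  exact (Module.finrank_mul_finrank F F⟮x⟯ F⟮x⟯⟮r⟯).symm

open IntermediateField in
theorem exists_quadratic_cube_root {r x : ℝ} {n : ℕ} (hn : 0 < n) (hr : IsRat (r ^ n))
    (hint : IsIntegral ℚ x) (hdeg : (minpoly ℚ x).natDegree = 3)
    (hx : x ∈ Algebra.adjoin ℚ ({r} : Set ℝ)) :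
    ∃ (a b c : ℚ) (s : ℝ), IsRat (s ^ 3) ∧ x = a + b * s + c * s ^ 2 := by
  obtain ⟨k, hk⟩ := hr
  have hxr : x ∈ ℚ⟮r⟯ := algebra_adjoin_le_adjoin ℚ _ hx
  have hfin : Module.finrank ℚ ℚ⟮x⟯ = 3 := (adjoin.finrank hint).trans hdeg
  have : FiniteDimensional ℚ ℚ⟮x⟯ := adjoin.finiteDimensional hint
  have hrint : IsIntegral ℚ r := by
    refine IsIntegral.of_pow hn ?_
    rw [← hk]
    exact isIntegral_algebraMap (R := ℚ) (A := ℝ) (x := k)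
  set e := (minpoly ℚ⟮x⟯ r).natDegree with he
  have he0 : 0 < e := minpoly.natDegree_pos hrint.tower_top
  have htower : (minpoly ℚ r).natDegree = 3 * e := by
    rw [natDegree_minpoly_eq_mul hrint hxr, hdeg]
  obtain ⟨⟨s, hsx⟩, hs⟩ : r ^ e ∈ Set.range (algebraMap ℚ⟮x⟯ ℝ) :=
    pow_natDegree_minpoly_mem_range_s1 hn ⟨algebraMap ℚ ℚ⟮x⟯ k, by simpa using hk⟩
  replace hs : s = r ^ e := hs
  have hs_not : ¬ IsRat s := by
    rintro ⟨t, ht⟩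
    have hmon := Polynomial.monic_X_pow_sub_C t he0.ne'
    have h1 := minpoly.min ℚ r hmon (by simp [← hs, ← ht])
    have h2 := Polynomial.natDegree_le_natDegree h1
    rw [htower, Polynomial.natDegree_X_pow_sub_C] at h2
    omega
  have hle : ℚ⟮s⟯ ≤ ℚ⟮x⟯ := adjoin_simple_le_iff.2 hsx
  have hsint : IsIntegral ℚ s := hs ▸ hrint.pow e
  have hsdeg : Module.finrank ℚ ℚ⟮s⟯ = 3 := by
    have hdvd : Module.finrank ℚ ℚ⟮s⟯ ∣ 3 := hfin ▸ finrank_dvd_of_le_right hle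
    rcases (Nat.dvd_prime Nat.prime_three).1 hdvd with h | h
    · obtain ⟨t, ht⟩ := mem_bot.1 (finrank_adjoin_simple_eq_one_iff.1 h)
      exact absurd ⟨t, by simpa using ht⟩ hs_not
    · exact h
  have heq : ℚ⟮s⟯ = ℚ⟮x⟯ := eq_of_le_of_finrank_eq hle (hsdeg.trans hfin.symm)
  have hcube : s ^ 3 ∈ Set.range (algebraMap ℚ ℝ) := by
    have h := pow_natDegree_minpoly_mem_range_s1 (K := ℚ) (r := s) hn
      ⟨k ^ e, by rw [hs, ← pow_mul, mul_comm, pow_mul, ← hk]; simp⟩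
    rwa [← adjoin.finrank hsint, hsdeg] at h
  obtain ⟨l, hl⟩ := hcube
  have hxs : x ∈ Algebra.adjoin ℚ ({s} : Set ℝ) := by
    rw [← adjoin_simple_toSubalgebra_of_isAlgebraic hsint.isAlgebraic, mem_toSubalgebra, heq]
    exact mem_adjoin_simple_self ℚ x
  have hl' : s ^ 3 = (l : ℝ) := by simpa using hl.symm
  obtain ⟨a, b, c, h⟩ := exists_quadratic_of_mem_adjoin hl' hxs
  exact ⟨a, b, c, s, ⟨l, hl'.symm⟩, h⟩

open Polynomial in
theorem eq_zero_of_quadratic_eq_zero {x : ℝ} (hdeg : (minpoly ℚ x).natDegree = 3) {a b c : ℚ}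
    (h : (a : ℝ) * x ^ 2 + b * x + c = 0) : a = 0 ∧ b = 0 ∧ c = 0 := by
  have hzero : (C a * X ^ 2 + C b * X + C c : ℚ[X]) = 0 := by
    by_contra hne
    have h1 := natDegree_le_of_dvd (minpoly.dvd ℚ x (by simpa using h)) hne
    have h2 := natDegree_quadratic_le (a := a) (b := b) (c := c)
    omega
  refine ⟨?_, ?_, ?_⟩
  · simpa [coeff_X, coeff_C] using congrArg (fun f : ℚ[X] => f.coeff 2) hzero
  · simpa [coeff_X, coeff_C] using congrArg (fun f : ℚ[X] => f.coeff 1) hzero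
  · simpa [coeff_X, coeff_C] using congrArg (fun f : ℚ[X] => f.coeff 0) hzero

theorem exists_sq_eq_discr {p q a b c k : ℚ} {s x : ℝ} (hs : s ^ 3 = k)
    (hxs : x = a + b * s + c * s ^ 2) (hx : x ^ 3 + p * x + q = 0)
    (hdeg : (minpoly ℚ x).natDegree = 3) :
    ∃ t : ℚ, t ^ 2 = (p / 3) ^ 3 + (q / 2) ^ 2 := by
  have hconj : (x - a) ^ 3 - 3 * b * c * k * (x - a) - (b ^ 3 * k + c ^ 3 * k ^ 2) = 0 := by
    rw [hxs, ← hs]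
    ring
  obtain ⟨h2, h1, h0⟩ := eq_zero_of_quadratic_eq_zero (x := x) hdeg (a := 3 * a)
    (b := p - 3 * a ^ 2 + 3 * b * c * k)
    (c := q + a ^ 3 - 3 * a * b * c * k + (b ^ 3 * k + c ^ 3 * k ^ 2))
    (by push_cast; linear_combination hx - hconj)
  obtain rfl : a = 0 := by linarith
  obtain rfl : p = -(3 * b * c * k) := by linarith
  obtain rfl : q = -(b ^ 3 * k + c ^ 3 * k ^ 2) := by linarith
  exact ⟨(b ^ 3 * k - c ^ 3 * k ^ 2) / 2, by ring⟩

/-- Every real number has a real cube root. -/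
theorem exists_real_cube_root (y : ℝ) : ∃ u : ℝ, u ^ 3 = y := by
  have hodd : Odd 3 := by decide
  have htop : Filter.Tendsto (fun u : ℝ => u ^ 3) Filter.atTop Filter.atTop :=
    Filter.tendsto_pow_atTop (by norm_num)
  have hbot : Filter.Tendsto (fun u : ℝ => u ^ 3) Filter.atBot Filter.atBot := by
    have h := Filter.tendsto_neg_atTop_atBot.comp (htop.comp Filter.tendsto_neg_atBot_atTop)
    refine h.congr fun u => ?_
    simp [hodd.neg_pow]
  exact (continuous_pow 3).surjective htop hbot y

/-- Cardano's formula. -/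
theorem exists_root_of_sq_eq_discr {p q t : ℚ} (ht : t ^ 2 = (p / 3) ^ 3 + (q / 2) ^ 2)
    (hne : -q / 2 + t ≠ 0) :
    ∃ (a b c : ℚ) (r : ℝ), IsRat (r ^ 3) ∧
      ((a : ℝ) + b * r + c * r ^ 2) ^ 3 + p * ((a : ℝ) + b * r + c * r ^ 2) + q = 0 := by
  obtain ⟨u, hu⟩ := exists_real_cube_root ((-q / 2 + t : ℚ) : ℝ)
  generalize hw : -q / 2 + t = w at *
  have hc : w + (-p / (3 * w)) ^ 3 * w ^ 2 = -q := by
    field_simp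
    rw [← hw]
    linear_combination 27 * ht
  have hb : 3 * (-p / (3 * w)) * w = -p := by field_simp
  refine ⟨0, 1, -p / (3 * w), u, ⟨w, hu.symm⟩, ?_⟩
  generalize -p / (3 * w) = c at *
  have hc_real : (w : ℝ) + c ^ 3 * w ^ 2 = -q := by exact_mod_cast hc
  have hb_real : 3 * (c : ℝ) * w = -p := by exact_mod_cast hb
  rw [← hu] at hc_real hb_real
  push_cast
  linear_combination hc_real + (u + c * u ^ 2) * hb_real

/-- For rational `p, q` and `D_{pq} = (p/3)^3 + (q/2)^2`, the following are
equivalent for the polynomial `x^3 + p x + q`: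
(i) it is 1-solvable;
(ii) it has a root of the form `a + b r + c r^2` with `a, b, c, r^3 ∈ ℚ`, `r ∈ ℝ`;
(iii) either it has a rational root, or `D_{pq} ≥ 0` and `√(D_{pq}) ∈ ℚ`. -/
theorem stmt_1 (p q : ℚ) :
    letI Dpq : ℚ := (p / 3) ^ 3 + (q / 2) ^ 2
    letI solvable : Prop := ∃ (r : ℝ) (n : ℕ), 0 < n ∧ IsRat (r ^ n) ∧
      ∃ x : ℝ, x ∈ Algebra.adjoin ℚ ({r} : Set ℝ) ∧ x ^ 3 + p * x + q = 0
    letI rootForm : Prop := ∃ (a b c : ℚ) (r : ℝ), IsRat (r ^ 3) ∧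
      ((a : ℝ) + b * r + c * r ^ 2) ^ 3 + p * ((a : ℝ) + b * r + c * r ^ 2) + q = 0
    letI discrCond : Prop :=
      (∃ x : ℚ, x ^ 3 + p * x + q = 0) ∨ (0 ≤ Dpq ∧ ∃ t : ℚ, t ^ 2 = Dpq)
    (solvable ↔ rootForm) ∧ (rootForm ↔ discrCond) := by
  have hrat : (∃ x : ℚ, x ^ 3 + p * x + q = 0) → ∃ (a b c : ℚ) (r : ℝ), IsRat (r ^ 3) ∧
      ((a : ℝ) + b * r + c * r ^ 2) ^ 3 + p * ((a : ℝ) + b * r + c * r ^ 2) + q = 0 := by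
    rintro ⟨x, hx⟩
    refine ⟨x, 0, 0, 0, ⟨0, by simp⟩, ?_⟩
    simp only [Rat.cast_zero, zero_mul, add_zero]
    exact_mod_cast hx
  refine ⟨⟨?_, ?_⟩, ⟨?_, ?_⟩⟩
  · rintro ⟨r, n, hn, hr, x, hxr, hx⟩
    by_cases hno : ∃ x : ℚ, x ^ 3 + p * x + q = 0
    · exact hrat hno
    · obtain ⟨hint, hdeg⟩ := natDegree_minpoly_eq_three hno hx
      obtain ⟨a, b, c, s, hs, rfl⟩ := exists_quadratic_cube_root hn hr hint hdeg hxr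
      exact ⟨a, b, c, s, hs, hx⟩
  · rintro ⟨a, b, c, r, hr, hx⟩
    refine ⟨r, 3, by norm_num, hr, _, ?_, hx⟩
    have hmem : r ∈ Algebra.adjoin ℚ ({r} : Set ℝ) := Algebra.self_mem_adjoin_singleton ℚ r
    have hcast (y : ℚ) : (y : ℝ) ∈ Algebra.adjoin ℚ ({r} : Set ℝ) :=
      Subalgebra.algebraMap_mem _ y
    exact add_mem (add_mem (hcast a) (mul_mem (hcast b) hmem))
      (mul_mem (hcast c) (pow_mem hmem 2))
  · rintro ⟨a, b, c, r, ⟨k, hk⟩, hx⟩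
    refine or_iff_not_imp_left.2 fun hno => ?_
    obtain ⟨-, hdeg⟩ := natDegree_minpoly_eq_three hno hx
    obtain ⟨t, ht⟩ := exists_sq_eq_discr hk.symm rfl hx hdeg
    exact ⟨ht ▸ sq_nonneg t, t, ht⟩
  · rintro (h | ⟨-, t, ht⟩)
    · exact hrat h
    · by_cases h1 : -q / 2 + t = 0
      · by_cases h2 : -q / 2 + -t = 0
        · refine hrat ⟨0, ?_⟩
          linarith
        · exact exists_root_of_sq_eq_discr (by rw [neg_sq, ht]) h2
      · exact exists_root_of_sq_eq_discr ht h1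
end

section
/- Assume that r is a real number with r ∉ ℚ and r^n ∈ ℚ for some integer n > 1. Let β ∈ ℚ[r]. Then there exists a positive integer k such that β ∈ ℚ[r^k] and r^k ∈ ℚ[β]; in other words, ℚ[r^k] = ℚ[β]. -/
open Polynomial in
/-- If `r` is real, `r ^ n` is rational and `r` has degree `m` over the subfield `F` of `ℝ`, then
`r ^ m ∈ F`. -/
theorem pow_natDegree_minpoly_mem {F : IntermediateField ℚ ℝ} {r : ℝ} {n : ℕ} (hn : n ≠ 0)
    {q : ℚ} (hq : (q : ℝ) = r ^ n) : r ^ (minpoly F r).natDegree ∈ F := by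
  have hdvd : minpoly F r ∣ X ^ n - C (algebraMap ℚ F q) := by
    apply minpoly.dvd
    have : algebraMap F ℝ (algebraMap ℚ F q) = r ^ n := by
      rw [← IsScalarTower.algebraMap_apply, ← hq]; rfl
    rw [map_sub, map_pow, aeval_X, aeval_C, this, sub_self]
  have hint : IsIntegral F r :=
    ⟨X ^ n - C (algebraMap ℚ F q), monic_X_pow_sub_C _ hn, by
      rw [← aeval_def]
      exact aeval_eq_zero_of_dvd_aeval_eq_zero hdvd (minpoly.aeval F r)⟩
  set φ : F →+* ℂ := (algebraMap ℝ ℂ).comp (algebraMap F ℝ) with hφ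
  set p := (minpoly F r).map φ with hp
  have hmonic : p.Monic := (minpoly.monic hint).map φ
  have hsplit : p.Splits := IsAlgClosed.splits p
  have hroot : ∀ z ∈ p.roots, ‖z‖ = |r| := by
    intro z hz
    have h0 : p.eval z = 0 := isRoot_of_mem_roots hz
    have h1 := eval_eq_zero_of_dvd_of_eval_eq_zero (Polynomial.map_dvd φ hdvd) h0
    have h2 : φ (algebraMap ℚ F q) = (r : ℂ) ^ n := by
      have : ((q : ℝ) : ℂ) = (r : ℂ) ^ n := by rw [hq]; push_cast; rfl
      rw [← this]; simp
    rw [Polynomial.map_sub, Polynomial.map_pow, map_X, map_C, h2] at h1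
    simp only [eval_sub, eval_pow, eval_X, eval_C, sub_eq_zero] at h1
    have h3 : ‖z‖ ^ n = |r| ^ n := by
      rw [← norm_pow, h1, norm_pow, Complex.norm_real, Real.norm_eq_abs]
    exact (pow_left_inj₀ (norm_nonneg _) (abs_nonneg _) hn).1 h3
  have hprod : ‖p.roots.prod‖ = |r| ^ p.natDegree := by
    have h1 : ‖p.roots.prod‖ = (p.roots.map norm).prod :=
      map_multiset_prod (normHom : ℂ →*₀ ℝ) p.roots
    rw [h1, Multiset.map_congr rfl hroot, Multiset.map_const', Multiset.prod_replicate,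
      ← hsplit.natDegree_eq_card_roots]
  have hcoeff : |algebraMap F ℝ ((minpoly F r).coeff 0)| = |r ^ (minpoly F r).natDegree| := by
    have h1 := hsplit.coeff_zero_eq_prod_roots_of_monic hmonic
    have h2 := congrArg norm h1
    rw [norm_mul, norm_pow, norm_neg, norm_one, one_pow, one_mul, hprod, hp, coeff_map,
      natDegree_map] at h2
    rw [abs_pow, ← h2, hφ, RingHom.comp_apply, Complex.coe_algebraMap, Complex.norm_real,
      Real.norm_eq_abs]
  have hmem : algebraMap F ℝ ((minpoly F r).coeff 0) ∈ F := ((minpoly F r).coeff 0).2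
  rcases abs_eq_abs.1 hcoeff with h | h
  · rwa [h] at hmem
  · rw [h] at hmem
    simpa using neg_mem hmem

open Polynomial in
/-- If the degree-th power of `r` lies in `F`, then `F ∩ ℚ[r]` is contained in the algebra
generated by that power. -/
theorem mem_adjoin_pow_natDegree_minpoly {F : IntermediateField ℚ ℝ} {r : ℝ}
    (hint : IsIntegral F r) (hpow : r ^ (minpoly F r).natDegree ∈ F) {β : ℝ} (hβF : β ∈ F)
    (hβ : β ∈ Algebra.adjoin ℚ ({r} : Set ℝ)) :
    β ∈ Algebra.adjoin ℚ ({r ^ (minpoly F r).natDegree} : Set ℝ) := by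
  set m := (minpoly F r).natDegree with hm
  have hm0 : m ≠ 0 := (minpoly.natDegree_pos hint).ne'
  set E := Algebra.adjoin ℚ ({r ^ m} : Set ℝ) with hE
  have hEF : E ≤ F.toSubalgebra := Algebra.adjoin_le (by simpa using hpow)
  rw [Algebra.adjoin_singleton_eq_range_aeval] at hβ
  obtain ⟨f, hf⟩ := hβ
  let d : E[X] := X ^ m - C ⟨r ^ m, Algebra.self_mem_adjoin_singleton ℚ (r ^ m)⟩
  have hd : d.Monic := monic_X_pow_sub_C _ hm0
  have hdr : aeval r d = 0 := by
    have : algebraMap E ℝ ⟨r ^ m, Algebra.self_mem_adjoin_singleton ℚ (r ^ m)⟩ = r ^ m := rfl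
    simp only [d, map_sub, map_pow, aeval_X, aeval_C, this, sub_self]
  set g := f.map (algebraMap ℚ E) %ₘ d with hg
  have hgr : aeval r g = β := by
    rw [hg, aeval_modByMonic_eq_self_of_root hdr, aeval_map_algebraMap]
    exact hf
  have hgdeg : g.degree < m := by
    have := degree_modByMonic_lt (f.map (algebraMap ℚ E)) hd
    rwa [show d.degree = m from degree_X_pow_sub_C (Nat.pos_of_ne_zero hm0) _] at this
  let ι : E →+* F := (Subalgebra.inclusion hEF).toRingHom
  have hι : (algebraMap F ℝ).comp ι = algebraMap E ℝ := rfl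
  have hzero : g.map ι - C (⟨β, hβF⟩ : F) = 0 := by
    by_contra hne
    have hroot : aeval r (g.map ι - C (⟨β, hβF⟩ : F)) = 0 := by
      rw [map_sub, aeval_C, aeval_def, eval₂_map, hι, ← aeval_def, hgr]
      exact sub_self β
    have hle := minpoly.degree_le_of_ne_zero F r hne hroot
    rw [degree_eq_natDegree (minpoly.ne_zero hint), ← hm] at hle
    refine hle.not_gt ((degree_sub_le _ _).trans_lt (max_lt (degree_map_le.trans_lt hgdeg) ?_))
    exact degree_C_le.trans_lt (by exact_mod_cast Nat.pos_of_ne_zero hm0)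
  have hcoeff : ι (g.coeff 0) = ⟨β, hβF⟩ := by
    simpa [sub_eq_zero] using congrArg (fun h => coeff h 0) hzero
  have : ((g.coeff 0 : E) : ℝ) = β := congrArg Subtype.val hcoeff
  exact this ▸ (g.coeff 0).2


/-- If `r` is an irrational real number with `r^n ∈ ℚ` for some integer
`n > 1`, then for every `β ∈ ℚ[r]` there is a positive integer `k` with
`β ∈ ℚ[r^k]` and `r^k ∈ ℚ[β]`. -/
theorem stmt_3 (r : ℝ) (hr : r ∉ Set.range ((↑) : ℚ → ℝ))
    (n : ℕ) (hn : 1 < n) (hrn : r ^ n ∈ Set.range ((↑) : ℚ → ℝ))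
    (β : ℝ) (hβ : β ∈ Algebra.adjoin ℚ ({r} : Set ℝ)) :
    ∃ k : ℕ, 0 < k ∧ β ∈ Algebra.adjoin ℚ ({r ^ k} : Set ℝ) ∧
      r ^ k ∈ Algebra.adjoin ℚ ({β} : Set ℝ) := by
  obtain ⟨q, hq⟩ := hrn
  have hn0 : n ≠ 0 := by omega
  have hr_int : IsIntegral ℚ r :=
    ⟨Polynomial.X ^ n - Polynomial.C q, Polynomial.monic_X_pow_sub_C _ hn0, by simp [hq]⟩
  have hβ_int : IsIntegral ℚ β :=
    adjoin_le_integralClosure hr_int hβ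
  let F := IntermediateField.adjoin ℚ ({β} : Set ℝ)
  have hF : F.toSubalgebra = Algebra.adjoin ℚ {β} :=
    IntermediateField.adjoin_simple_toSubalgebra_of_isAlgebraic hβ_int.isAlgebraic
  have hint : IsIntegral F r := hr_int.tower_top
  have hpow : r ^ (minpoly F r).natDegree ∈ F := pow_natDegree_minpoly_mem hn0 hq
  refine ⟨(minpoly F r).natDegree, minpoly.natDegree_pos hint,
    mem_adjoin_pow_natDegree_minpoly hint hpow
      (IntermediateField.mem_adjoin_simple_self ℚ β) hβ, ?_⟩
  rw [← hF]
  exact hpow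
end

section
/- Let a, b, c, d ∈ ℚ and let r be a real number with r^2 ∉ ℚ and r^4 ∈ ℚ. Let F be a polynomial with rational coefficients such that x_0 = a + b r + c r^2 + d r^3 is a root of F. Then the complex numbers x_1 = a − b r + c r^2 − d r^3, x_2 = a + b r i − c r^2 − d r^3 i, and x_3 = a − b r i − c r^2 + d r^3 i are also roots of F (viewing F as a polynomial over ℂ). -/
open Polynomial Complex

theorem Irrational.rat_add_mul_eq_zero {s : ℝ} (hs : Irrational s) {x y : ℚ}
    (h : (x : ℝ) + y * s = 0) : x = 0 ∧ y = 0 := by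
  have hy : y = 0 := by
    by_contra hy
    refine hs ⟨-x / y, ?_⟩
    have hy' : (y : ℝ) ≠ 0 := by exact_mod_cast hy
    push_cast
    field_simp
    linarith
  subst hy
  simpa using h

/-- If `r ^ 2` is irrational and `r ^ 4` is rational, then `1, r, r ^ 2, r ^ 3` are linearly
independent over `ℚ`. -/
theorem cubic_coeffs_eq_zero_of_irrational_sq {r : ℝ} {q : ℚ} (hr : Irrational (r ^ 2))
    (hq : (q : ℝ) = r ^ 4) {u v w z : ℚ}
    (h : (u : ℝ) + v * r + w * r ^ 2 + z * r ^ 3 = 0) :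
    u = 0 ∧ v = 0 ∧ w = 0 ∧ z = 0 := by
  have hspos : 0 < r ^ 2 := lt_of_le_of_ne (sq_nonneg r) hr.ne_zero.symm
  have hsq : ((u : ℝ) + w * r ^ 2) ^ 2 = r ^ 2 * (v + z * r ^ 2) ^ 2 := by
    linear_combination (u + w * r ^ 2 - r * (v + z * r ^ 2)) * h
  obtain ⟨h₁, h₂⟩ := hr.rat_add_mul_eq_zero
    (x := u ^ 2 + w ^ 2 * q - 2 * v * z * q) (y := 2 * u * w - v ^ 2 - z ^ 2 * q) (by
      push_cast
      rw [hq]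
      linear_combination hsq)
  have h₁' : (u : ℝ) ^ 2 + w ^ 2 * q - 2 * v * z * q = 0 := by exact_mod_cast h₁
  have h₂' : 2 * (u : ℝ) * w - v ^ 2 - z ^ 2 * q = 0 := by exact_mod_cast h₂
  rw [hq] at h₁' h₂'
  have hconj : ((u : ℝ) - w * r ^ 2) ^ 2 = -(r ^ 2 * (v - z * r ^ 2) ^ 2) := by
    linear_combination h₁' - r ^ 2 * h₂'
  have hvz : ((v : ℝ) - z * r ^ 2) ^ 2 = 0 := by
    have hnonneg : 0 ≤ r ^ 2 * ((v : ℝ) - z * r ^ 2) ^ 2 := by positivity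
    have hzero : r ^ 2 * ((v : ℝ) - z * r ^ 2) ^ 2 = 0 := by
      linarith [sq_nonneg ((u : ℝ) - w * r ^ 2)]
    exact (mul_eq_zero.mp hzero).resolve_left hspos.ne'
  have huw : ((u : ℝ) - w * r ^ 2) ^ 2 = 0 := by rw [hconj, hvz]; simp
  obtain ⟨hv, hz⟩ := hr.rat_add_mul_eq_zero (x := v) (y := -z) (by
    push_cast
    linear_combination pow_eq_zero_iff two_ne_zero |>.mp hvz)
  obtain ⟨hu, hw⟩ := hr.rat_add_mul_eq_zero (x := u) (y := -w) (by
    push_cast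
    linear_combination pow_eq_zero_iff two_ne_zero |>.mp huw)
  exact ⟨hu, hv, neg_eq_zero.mp hw, neg_eq_zero.mp hz⟩

theorem X_pow_four_sub_C_dvd_of_aeval_eq_zero {r : ℝ} {q : ℚ} (hr : Irrational (r ^ 2))
    (hq : (q : ℝ) = r ^ 4) {P : ℚ[X]} (hP : aeval (r : ℂ) P = 0) :
    X ^ 4 - C q ∣ P := by
  have hmonic : (X ^ 4 - C q : ℚ[X]).Monic := monic_X_pow_sub_C q four_ne_zero
  rw [← modByMonic_eq_zero_iff_dvd hmonic]
  set R := P %ₘ (X ^ 4 - C q) with hR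
  have hqC : (q : ℂ) = (r : ℂ) ^ 4 := by exact_mod_cast congrArg ((↑) : ℝ → ℂ) hq
  have hroot : aeval (r : ℂ) (X ^ 4 - C q : ℚ[X]) = 0 := by simp [hqC]
  have hRr : aeval (r : ℂ) R = 0 := by
    rw [hR, aeval_modByMonic_eq_self_of_root hroot, hP]
  have hdeg : R.natDegree < 4 := by
    have := natDegree_modByMonic_lt P hmonic (fun h => by
      simpa [natDegree_X_pow_sub_C] using congrArg natDegree h)
    rwa [natDegree_X_pow_sub_C] at this
  rw [aeval_eq_sum_range' hdeg] at hRr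
  simp only [Finset.sum_range_succ, Finset.sum_range_zero, Rat.smul_def] at hRr
  obtain ⟨h0, h1, h2, h3⟩ := cubic_coeffs_eq_zero_of_irrational_sq hr hq
    (u := R.coeff 0) (v := R.coeff 1) (w := R.coeff 2) (z := R.coeff 3) (by
      have : ((R.coeff 0 + R.coeff 1 * r + R.coeff 2 * r ^ 2 + R.coeff 3 * r ^ 3 : ℝ) : ℂ) = 0 := by
        push_cast
        linear_combination hRr
      exact_mod_cast this)
  ext n
  rcases lt_or_ge n 4 with hn | hn
  · interval_cases n <;> simpa
  · simpa using coeff_eq_zero_of_natDegree_lt (hdeg.trans_le hn)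

/-- A rational polynomial vanishing at a rational cubic expression in `r` vanishes at the
expression obtained by replacing `r` with any other complex fourth root of `r ^ 4`. -/
theorem aeval_cubic_eq_zero_of_pow_four_eq {r : ℝ} {q : ℚ} (hr : Irrational (r ^ 2))
    (hq : (q : ℝ) = r ^ 4) {a b c d : ℚ} {F : ℚ[X]}
    (hF : aeval ((a : ℂ) + b * (r : ℂ) + c * (r : ℂ) ^ 2 + d * (r : ℂ) ^ 3) F = 0)
    {t : ℂ} (ht : t ^ 4 = (r : ℂ) ^ 4) :
    aeval ((a : ℂ) + b * t + c * t ^ 2 + d * t ^ 3) F = 0 := by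
  have key (y : ℂ) : aeval y (F.comp (C a + C b * X + C c * X ^ 2 + C d * X ^ 3)) =
      aeval ((a : ℂ) + b * y + c * y ^ 2 + d * y ^ 3) F := by
    simp [aeval_comp]
  rw [← key] at hF ⊢
  obtain ⟨Q, hQ⟩ := X_pow_four_sub_C_dvd_of_aeval_eq_zero hr hq hF
  have hqC : (q : ℂ) = (r : ℂ) ^ 4 := by exact_mod_cast congrArg ((↑) : ℝ → ℂ) hq
  rw [hQ]
  simp [hqC, ht]

/-- Conjugation Lemma, quartic case: Let `a, b, c, d ∈ ℚ` and `r ∈ ℝ` with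
`r^2 ∉ ℚ` and `r^4 ∈ ℚ`. If `F` is a polynomial with rational coefficients having
`x₀ = a + b r + c r^2 + d r^3` as a root, then `x₁ = a − b r + c r^2 − d r^3`,
`x₂ = a + b r i − c r^2 − d r^3 i` and `x₃ = a − b r i − c r^2 + d r^3 i`
are also roots of `F` over `ℂ`. -/
theorem stmt_5 (a b c d : ℚ) (r : ℝ)
    (hr2 : r ^ 2 ∉ Set.range ((↑) : ℚ → ℝ))
    (hr4 : r ^ 4 ∈ Set.range ((↑) : ℚ → ℝ))
    (F : Polynomial ℚ)
    (hroot : Polynomial.aeval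
      ((a : ℂ) + b * (r : ℂ) + c * (r : ℂ) ^ 2 + d * (r : ℂ) ^ 3) F = 0) :
    Polynomial.aeval ((a : ℂ) - b * (r : ℂ) + c * (r : ℂ) ^ 2 - d * (r : ℂ) ^ 3) F = 0 ∧
    Polynomial.aeval ((a : ℂ) + b * (r : ℂ) * Complex.I - c * (r : ℂ) ^ 2
      - d * (r : ℂ) ^ 3 * Complex.I) F = 0 ∧
    Polynomial.aeval ((a : ℂ) - b * (r : ℂ) * Complex.I - c * (r : ℂ) ^ 2
      + d * (r : ℂ) ^ 3 * Complex.I) F = 0 := by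
  obtain ⟨q, hq⟩ := hr4
  have conj {t : ℂ} (ht : t ^ 4 = (r : ℂ) ^ 4) :=
    aeval_cubic_eq_zero_of_pow_four_eq hr2 hq hroot ht
  refine ⟨?_, ?_, ?_⟩
  · convert conj (t := -r) (by ring) using 3
    ring
  · convert conj (t := r * I) (by rw [mul_pow, I_pow_four, mul_one]) using 3
    rw [mul_pow, mul_pow, I_sq, I_pow_three]
    ring
  · convert conj (t := -(r * I)) (by rw [neg_pow, mul_pow, I_pow_four]; ring) using 3
    rw [neg_pow _ 2, neg_pow _ 3, mul_pow, mul_pow, I_sq, I_pow_three]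
    ring
end

section
/- Let r be a real number and b, c, d rational numbers with r^4 ∈ ℚ, r^2 ∉ ℚ, and b^2 + d^2 ≠ 0, and let a ∈ ℚ. Then the four complex numbers x_0 = a + b r + c r^2 + d r^3, x_1 = a − b r + c r^2 − d r^3, x_2 = a + b r i − c r^2 − d r^3 i, x_3 = a − b r i − c r^2 + d r^3 i are pairwise distinct. -/
open Complex

/-- If `r ^ 2` is irrational, a nonzero rational linear combination of `r` and `r ^ 3`
does not vanish. -/
theorem mul_add_mul_pow_three_ne_zero {r : ℝ} {b d : ℚ}
    (hr2 : r ^ 2 ∉ Set.range ((↑) : ℚ → ℝ)) (hbd : b ^ 2 + d ^ 2 ≠ 0) :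
    (b : ℝ) * r + d * r ^ 3 ≠ 0 := by
  intro h
  have hr : r ≠ 0 := by
    rintro rfl
    exact hr2 ⟨0, by simp⟩
  have h' : (b : ℝ) + d * r ^ 2 = 0 :=
    mul_left_cancel₀ hr (by linear_combination h)
  by_cases hd : d = 0
  · subst hd
    have hb : b = 0 := by simpa using h'
    exact hbd (by simp [hb])
  · have hd' : (d : ℝ) ≠ 0 := by exact_mod_cast hd
    refine hr2 ⟨-b / d, ?_⟩
    push_cast
    rw [div_eq_iff hd']
    linear_combination -h'

/-- If `r ∈ ℝ` with `r^4 ∈ ℚ`, `r^2 ∉ ℚ` and `b, c, d ∈ ℚ` with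
`b^2 + d^2 ≠ 0`, and `a ∈ ℚ`, then the four complex numbers
`x₀ = a + b r + c r² + d r³`, `x₁ = a − b r + c r² − d r³`,
`x₂ = a + b r i − c r² − d r³ i`, `x₃ = a − b r i − c r² + d r³ i`
are pairwise distinct. -/
theorem stmt_8 (r : ℝ) (a b c d : ℚ)
    (hr4 : r ^ 4 ∈ Set.range ((↑) : ℚ → ℝ))
    (hr2 : r ^ 2 ∉ Set.range ((↑) : ℚ → ℝ))
    (hbd : b ^ 2 + d ^ 2 ≠ 0) :
    letI x0 : ℂ := (a : ℂ) + b * (r : ℂ) + c * (r : ℂ) ^ 2 + d * (r : ℂ) ^ 3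
    letI x1 : ℂ := (a : ℂ) - b * (r : ℂ) + c * (r : ℂ) ^ 2 - d * (r : ℂ) ^ 3
    letI x2 : ℂ := (a : ℂ) + b * (r : ℂ) * Complex.I - c * (r : ℂ) ^ 2
      - d * (r : ℂ) ^ 3 * Complex.I
    letI x3 : ℂ := (a : ℂ) - b * (r : ℂ) * Complex.I - c * (r : ℂ) ^ 2
      + d * (r : ℂ) ^ 3 * Complex.I
    x0 ≠ x1 ∧ x0 ≠ x2 ∧ x0 ≠ x3 ∧ x1 ≠ x2 ∧ x1 ≠ x3 ∧ x2 ≠ x3 := by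
  have hadd := mul_add_mul_pow_three_ne_zero hr2 hbd
  have hsub : (b : ℝ) * r - d * r ^ 3 ≠ 0 := by
    have := mul_add_mul_pow_three_ne_zero (b := b) (d := -d) hr2 (by rwa [neg_sq])
    simpa [sub_eq_add_neg] using this
  refine ⟨fun h => hadd ?_, fun h => hsub ?_, fun h => hsub ?_, fun h => hsub ?_,
    fun h => hsub ?_, fun h => hsub ?_⟩
  · have h := congrArg Complex.re h
    simp [← Complex.ofReal_pow] at h
    linarith
  all_goals
    have h := congrArg Complex.im h
    simp [← Complex.ofReal_pow] at h
    linarith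
end

section
/- Let p, q, s be complex numbers and let x_0, x_1, x_2, x_3 be complex numbers such that X^4 + p X^2 + q X + s = (X − x_0)(X − x_1)(X − x_2)(X − x_3) as polynomials in X. Set α = (x_0 x_2 + x_1 x_3)/2. Then q^2 − 4(p − 2α)(s − α^2) = 0. -/
/-- If `x₀, x₁, x₂, x₃` are the roots of `X⁴ + p X² + q X + s` and
`α = (x₀x₂ + x₁x₃)/2`, then `q² − 4(p − 2α)(s − α²) = 0`. -/
theorem stmt_11 (p q s x0 x1 x2 x3 : ℂ)
    (h : ∀ X : ℂ, X ^ 4 + p * X ^ 2 + q * X + s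
      = (X - x0) * (X - x1) * (X - x2) * (X - x3)) :
    letI α : ℂ := (x0 * x2 + x1 * x3) / 2
    q ^ 2 - 4 * (p - 2 * α) * (s - α ^ 2) = 0 := by
  have h0 := h 0
  have h1 := h 1
  have h2 := h (-1)
  have h3 := h 2
  have hs : s = x0 * x1 * x2 * x3 := by linear_combination h0
  have hp : p = x0 * x1 + x0 * x2 + x0 * x3 + x1 * x2 + x1 * x3 + x2 * x3 := by
    linear_combination (h1 + h2) / 2 - h0
  have hx : x3 = -(x0 + x1 + x2) := by
    linear_combination h0 / 2 - h1 / 2 - h2 / 6 + h3 / 6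
  have hq : q = -(x0 * x1 * x2 + x0 * x1 * x3 + x0 * x2 * x3 + x1 * x2 * x3) := by
    linear_combination (h1 - h2) / 2 - hx
  rw [hs, hp, hq, hx]
  ring
end

section
/- Let p, q, s be complex numbers and let x_0, x_1, x_2, x_3 be complex numbers such that X^4 + p X^2 + q X + s = (X − x_0)(X − x_1)(X − x_2)(X − x_3) as polynomials in X. Set α = (x_0 x_2 + x_1 x_3)/2 and Γ = 16(α^2 − s)^2 − (α^2 − s)(2α + p)^2. Then 4Γ = −(x_0 x_2 − x_1 x_3)^2 (x_1 − x_3)^2 (x_0 − x_2)^2. -/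
/-- If `x₀, x₁, x₂, x₃` are the roots of `X⁴ + p X² + q X + s`,
`α = (x₀x₂ + x₁x₃)/2` and `Γ = 16(α² − s)² − (α² − s)(2α + p)²`, then
`4Γ = −(x₀x₂ − x₁x₃)²(x₁ − x₃)²(x₀ − x₂)²`. -/
theorem stmt_12 (p q s x0 x1 x2 x3 : ℂ)
    (h : ∀ X : ℂ, X ^ 4 + p * X ^ 2 + q * X + s
      = (X - x0) * (X - x1) * (X - x2) * (X - x3)) :
    letI α : ℂ := (x0 * x2 + x1 * x3) / 2
    letI Γ : ℂ := 16 * (α ^ 2 - s) ^ 2 - (α ^ 2 - s) * (2 * α + p) ^ 2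
    4 * Γ = -((x0 * x2 - x1 * x3) ^ 2 * (x1 - x3) ^ 2 * (x0 - x2) ^ 2) := by
  have hs : s = x0 * x1 * x2 * x3 := by linear_combination h 0
  have hsum : x0 + x1 + x2 + x3 = 0 := by
    linear_combination (h 2 - h (-2) - 2 * (h 1 - h (-1))) / 12
  have hp : p = x0 * x1 + x0 * x2 + x0 * x3 + x1 * x2 + x1 * x3 + x2 * x3 := by
    linear_combination (h 1 + h (-1) - 2 * h 0) / 2
  have hx3 : x3 = -x0 - x1 - x2 := by linear_combination hsum
  subst hs hp hx3
  ring
end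

section
/- Let r be a real number and d a positive integer such that r^d ∈ ℚ but r^t ∉ ℚ for every integer t with 1 ≤ t < d. Then the polynomial x^d − r^d is irreducible over ℚ. -/
open Polynomial

/-- If every complex root of a monic rational polynomial has absolute value `s`, then its
constant coefficient has absolute value `s ^ natDegree`. -/
theorem abs_coeff_zero_eq_pow_natDegree_of_norm_root_eq {p : ℚ[X]} (hp : p.Monic) {s : ℝ}
    (hs : ∀ z : ℂ, aeval z p = 0 → ‖z‖ = s) :
    |((p.coeff 0 : ℚ) : ℝ)| = s ^ p.natDegree := by
  set P := p.map (algebraMap ℚ ℂ) with hP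
  have hsplit : P.Splits := IsAlgClosed.splits P
  have hcoeff := hsplit.coeff_zero_eq_prod_roots_of_monic (hp.map _)
  have hroots : P.roots.map (fun z ↦ ‖z‖) = Multiset.replicate p.natDegree s := by
    rw [Multiset.eq_replicate, Multiset.card_map, ← hsplit.natDegree_eq_card_roots,
      hP, natDegree_map]
    refine ⟨rfl, fun b hb ↦ ?_⟩
    obtain ⟨z, hz, rfl⟩ := Multiset.mem_map.1 hb
    refine hs z ?_
    rw [← eval_map_algebraMap]
    exact (mem_roots'.1 hz).2
  have hprod : ‖P.roots.prod‖ = (P.roots.map (fun z ↦ ‖z‖)).prod :=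
    (Multiset.prod_hom P.roots (normHom (α := ℂ))).symm
  have hnorm := congrArg norm hcoeff
  rw [norm_mul, norm_pow, norm_neg, norm_one, one_pow, one_mul, hprod, hroots,
    Multiset.prod_replicate, hP, coeff_map] at hnorm
  simpa using hnorm

/-- If `r ∈ ℝ` and `d` is a positive integer with `r^d` rational (equal to
the rational number `q0`) but `r^t` irrational for all integers `1 ≤ t < d`, then the
polynomial `x^d − r^d` is irreducible over `ℚ`. -/
theorem stmt_15 (r : ℝ) (d : ℕ) (hd : 0 < d) (q0 : ℚ) (hq0 : (q0 : ℝ) = r ^ d)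
    (ht : ∀ t : ℕ, 1 ≤ t → t < d → r ^ t ∉ Set.range ((↑) : ℚ → ℝ)) :
    Irreducible (X ^ d - C q0 : Polynomial ℚ) := by
  have hmonic : (X ^ d - C q0 : ℚ[X]).Monic := monic_X_pow_sub_C q0 hd.ne'
  have hroot : aeval r (X ^ d - C q0 : ℚ[X]) = 0 := by simp [hq0]
  have hint : IsIntegral ℚ r := ⟨_, hmonic, hroot⟩
  have hdvd : minpoly ℚ r ∣ X ^ d - C q0 := minpoly.dvd ℚ r hroot
  have hnorm : ∀ z : ℂ, aeval z (minpoly ℚ r) = 0 → ‖z‖ = |r| := by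
    intro z hz
    have hz' : z ^ d = (q0 : ℂ) := by
      simpa [sub_eq_zero] using aeval_eq_zero_of_dvd_aeval_eq_zero hdvd hz
    rw [← pow_left_inj₀ (norm_nonneg z) (abs_nonneg r) hd.ne', ← norm_pow, hz', ← abs_pow, ← hq0]
    simp
  have habs := abs_coeff_zero_eq_pow_natDegree_of_norm_root_eq (minpoly.monic hint) hnorm
  have hrat : r ^ (minpoly ℚ r).natDegree ∈ Set.range ((↑) : ℚ → ℝ) := by
    rw [← abs_pow, abs_eq_abs] at habs
    obtain h | h := habs
    · exact ⟨_, h⟩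
    · exact ⟨-(minpoly ℚ r).coeff 0, by rw [Rat.cast_neg, h, neg_neg]⟩
  have hdeg : d ≤ (minpoly ℚ r).natDegree :=
    not_lt.1 fun hlt ↦ ht _ (minpoly.natDegree_pos hint) hlt hrat
  rw [eq_of_monic_of_dvd_of_natDegree_le (minpoly.monic hint) hmonic hdvd
    (by rwa [natDegree_X_pow_sub_C])]
  exact minpoly.irreducible hint
end

section
/- Let p, q ∈ ℚ and let a, b, c ∈ ℚ, r ∈ ℝ with r ∉ ℚ, r^3 ∈ ℚ, and (b, c) ≠ (0, 0). Suppose a + b r + c r^2 is a root of x^3 + p x + q. Then 4 D_{pq} = ((b r)^3 − (c r^2)^3)^2, where D_{pq} = (p/3)^3 + (q/2)^2; in particular D_{pq} ≥ 0 and √(D_{pq}) is rational. -/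
/-- A real number whose cube equals the cube of a rational number is rational. -/
lemma mem_range_ratCast_of_mul_pow_three_eq {r : ℝ} {s y z : ℚ} (hs : r ^ 3 = s) (hz : z ≠ 0)
    (h : z ^ 3 * s = y ^ 3) : r ∈ Set.range ((↑) : ℚ → ℝ) := by
  refine ⟨y / z, ?_⟩
  have h3 : ((y / z : ℚ) : ℝ) ^ 3 = r ^ 3 := by
    rw [hs]
    have : (y / z) ^ 3 = s := by
      field_simp
      linarith
    exact_mod_cast this
  exact (Odd.strictMono_pow (by decide : Odd 3)).injective h3

/-- The numbers `1` and `r` are linearly independent over `ℚ` when `r` is irrational. -/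
lemma eq_zero_of_add_mul_eq_zero {r : ℝ} (hr : r ∉ Set.range ((↑) : ℚ → ℝ)) {x y : ℚ}
    (h : (x : ℝ) + y * r = 0) : x = 0 ∧ y = 0 := by
  have hy : y = 0 := by
    by_contra hy
    refine hr ⟨-x / y, ?_⟩
    have : (y : ℝ) ≠ 0 := by exact_mod_cast hy
    push_cast
    field_simp
    linarith
  subst hy
  simpa using h

/-- The numbers `1`, `r`, `r ^ 2` are linearly independent over `ℚ` when `r` is an irrational
cube root of a rational number. -/
lemma eq_zero_of_add_mul_add_mul_sq_eq_zero {r : ℝ} (hr : r ∉ Set.range ((↑) : ℚ → ℝ)) {s : ℚ}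
    (hs : r ^ 3 = s) {x y z : ℚ} (h : (x : ℝ) + y * r + z * r ^ 2 = 0) :
    x = 0 ∧ y = 0 ∧ z = 0 := by
  have hz : z = 0 := by
    by_contra hz
    obtain ⟨h1, h2⟩ := eq_zero_of_add_mul_eq_zero hr (x := z ^ 2 * s - x * y)
      (y := z * x - y ^ 2) (by
        push_cast
        linear_combination (z * r - y) * h - (z : ℝ) ^ 2 * hs)
    exact hr (mem_range_ratCast_of_mul_pow_three_eq hs hz (y := y)
      (by linear_combination z * h1 + y * h2))
  subst hz
  obtain ⟨hx, hy⟩ := eq_zero_of_add_mul_eq_zero hr (x := x) (y := y) (by simpa using h)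
  exact ⟨hx, hy, rfl⟩


/-- If `p, q, a, b, c ∈ ℚ`, `r ∈ ℝ` with `r ∉ ℚ`, `r³ ∈ ℚ`,
`(b, c) ≠ (0, 0)`, and `a + b r + c r²` is a root of `x³ + p x + q`, then
`4 D_{pq} = ((b r)³ − (c r²)³)²` where `D_{pq} = (p/3)³ + (q/2)²`; in particular
`D_{pq} ≥ 0` and `√(D_{pq})` is rational. -/
theorem stmt_17 (p q a b c : ℚ) (r : ℝ)
    (hr : r ∉ Set.range ((↑) : ℚ → ℝ))
    (hr3 : r ^ 3 ∈ Set.range ((↑) : ℚ → ℝ))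
    (hbc : (b, c) ≠ (0, 0))
    (hroot : ((a : ℝ) + b * r + c * r ^ 2) ^ 3 + p * ((a : ℝ) + b * r + c * r ^ 2) + q
      = 0) :
    letI Dpq : ℚ := (p / 3) ^ 3 + (q / 2) ^ 2
    (4 * (Dpq : ℝ) = (((b : ℝ) * r) ^ 3 - ((c : ℝ) * r ^ 2) ^ 3) ^ 2) ∧
    0 ≤ Dpq ∧ Real.sqrt (Dpq : ℝ) ∈ Set.range ((↑) : ℚ → ℝ) := by
  obtain ⟨s, hs⟩ := hr3
  replace hs := hs.symm
  obtain ⟨hA, hB, hC⟩ := eq_zero_of_add_mul_add_mul_sq_eq_zero hr hs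
    (x := a ^ 3 + b ^ 3 * s + c ^ 3 * s ^ 2 + 6 * a * b * c * s + p * a + q)
    (y := 3 * a ^ 2 * b + 3 * a * c ^ 2 * s + 3 * b ^ 2 * c * s + p * b)
    (z := 3 * a ^ 2 * c + 3 * a * b ^ 2 + 3 * b * c ^ 2 * s + p * c) (by
      push_cast
      rw [← hs]
      linear_combination hroot)
  have hbc' : c ^ 3 * s - b ^ 3 ≠ 0 := by
    intro h
    have hc : c = 0 := by
      by_contra hc
      exact hr (mem_range_ratCast_of_mul_pow_three_eq hs hc (sub_eq_zero.mp h))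
    subst hc
    have hb : b = 0 := by simpa using h
    exact hbc (by rw [hb])
  have ha : a = 0 := by
    have : a * (c ^ 3 * s - b ^ 3) = 0 := by
      linear_combination (c * hB - b * hC) / 3
    exact (mul_eq_zero.mp this).resolve_right hbc'
  subst ha
  have hp : p = -3 * b * c * s := by
    have : (p + 3 * b * c * s) * (c ^ 3 * s - b ^ 3) = 0 := by
      linear_combination c ^ 2 * s * hC - b ^ 2 * hB
    linear_combination (mul_eq_zero.mp this).resolve_right hbc'
  have hq : q = -(b ^ 3 * s + c ^ 3 * s ^ 2) := by linear_combination hA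
  have hD : (p / 3) ^ 3 + (q / 2) ^ 2 = ((b ^ 3 * s - c ^ 3 * s ^ 2) / 2) ^ 2 := by
    rw [hp, hq]
    ring
  rw [hD]
  refine ⟨?_, sq_nonneg _, |(b ^ 3 * s - c ^ 3 * s ^ 2) / 2|, ?_⟩
  · push_cast
    rw [← hs]
    ring
  · rw [Rat.cast_pow, Real.sqrt_sq_eq_abs, Rat.cast_abs]
end

section
/- Let p, q, s ∈ ℚ and α ∈ ℚ satisfy 2α > p, α^2 − s > 0, q^2 − 4(p − 2α)(s − α^2) = 0, and suppose Γ = 16(α^2 − s)^2 − (α^2 − s)(2α + p)^2 is the square of a rational number. Then 16(α^2 − s) − (2α + p)^2 ≥ 0, and for the real number r ≥ 0 defined by 2 r^2 = 4√(α^2 − s) + √(16(α^2 − s) − (2α + p)^2) one has r^4 ∈ ℚ, and the polynomial x^4 + p x^2 + q x + s has a real root of the form b r + c r^2 + d r^3 with b, c, d ∈ ℚ; in particular, x^4 + p x^2 + q x + s is 1-solvable. -/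
/-- If `w * D + y` satisfies the relations produced by factoring a quartic whose resolvent
cubic has the root `α`, then it is a root of that quartic. -/
lemma quartic_eq_zero_of_resolvent {p q s α D w y : ℝ} (hD : D ^ 2 = α ^ 2 - s)
    (hw : 4 * w * (α ^ 2 - s) = -q) (hw2 : 4 * w ^ 2 * (α ^ 2 - s) = 2 * α - p)
    (hy : y ^ 2 = D - (2 * α + p) / 4) :
    (w * D + y) ^ 4 + p * (w * D + y) ^ 2 + q * (w * D + y) + s = 0 := by
  have hx : (w * D + y) ^ 2 = 2 * w * D * y + D - p / 2 := by
    linear_combination w ^ 2 * hD + hy + hw2 / 4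
  have hqw : q * w = -(2 * α - p) := by linear_combination w * hw - hw2
  calc (w * D + y) ^ 4 + p * (w * D + y) ^ 2 + q * (w * D + y) + s
      = ((w * D + y) ^ 2 + p / 2) ^ 2 - p ^ 2 / 4 + q * (w * D + y) + s := by ring
    _ = (2 * w * D * y + D) ^ 2 - p ^ 2 / 4 + q * (w * D + y) + s := by rw [hx]; ring
    _ = 0 := by
      linear_combination (4 * w ^ 2 * y ^ 2 + 4 * w * y + 1) * hD + y * hw + y ^ 2 * hw2
        + (2 * α - p) * hy + D * hqw

/-- The radical `r` has rational fourth power and generates a root of the quartic. -/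
lemma exists_root_of_radical {p q s α : ℚ} (hαs : α ^ 2 - s > 0)
    (hres : q ^ 2 - 4 * (p - 2 * α) * (s - α ^ 2) = 0)
    {g : ℚ} (hΓ : 16 * (α ^ 2 - s) ^ 2 - (α ^ 2 - s) * (2 * α + p) ^ 2 = g ^ 2)
    {r : ℝ} (hr : 2 * r ^ 2 = 4 * Real.sqrt ((α ^ 2 - s : ℚ))
        + Real.sqrt ((16 * (α ^ 2 - s) - (2 * α + p) ^ 2 : ℚ))) :
    IsRat (r ^ 4) ∧
      ∃ b c d : ℚ,
        ((b : ℝ) * r + c * r ^ 2 + d * r ^ 3) ^ 4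
          + p * ((b : ℝ) * r + c * r ^ 2 + d * r ^ 3) ^ 2
          + q * ((b : ℝ) * r + c * r ^ 2 + d * r ^ 3) + s = 0 := by
  obtain ⟨δ, hδ⟩ : ∃ δ, δ = α ^ 2 - s := ⟨_, rfl⟩
  obtain ⟨t, ht⟩ : ∃ t, t = 2 * α + p := ⟨_, rfl⟩
  obtain ⟨K, hK⟩ : ∃ K, K = 2 + |g| / (2 * δ) := ⟨_, rfl⟩
  rw [← hδ, ← ht] at hr hΓ
  rw [← hδ] at hαs
  have hK0 : 0 < K := by rw [hK]; positivity
  have hgK : |g| = 2 * δ * (K - 2) := by rw [hK]; field_simp; ring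
  have hKt : 4 * K ^ 2 * δ + t ^ 2 = 16 * K * δ := by
    rw [← sq_abs g, hgK] at hΓ
    apply mul_left_cancel₀ hαs.ne'
    linear_combination -hΓ
  have hδR : (0 : ℝ) < δ := by exact_mod_cast hαs
  have hKR : (0 : ℝ) < K := by exact_mod_cast hK0
  have hKtR : 4 * (K : ℝ) ^ 2 * δ + t ^ 2 = 16 * K * δ := by exact_mod_cast hKt
  have hDF : √(δ : ℝ) * √((16 * δ - t ^ 2 : ℚ) : ℝ) = 2 * δ * (K - 2) := by
    have hg : (δ : ℝ) * ((16 * δ - t ^ 2 : ℚ) : ℝ) = (g : ℝ) ^ 2 := by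
      rw [← Rat.cast_mul, ← Rat.cast_pow, ← hΓ]; congr 1; ring
    rw [← Real.sqrt_mul hδR.le, hg, Real.sqrt_sq_eq_abs]
    exact_mod_cast hgK
  have hD : √(δ : ℝ) ^ 2 = δ := Real.sq_sqrt hδR.le
  have hD0 : √(δ : ℝ) ≠ 0 := (Real.sqrt_pos.2 hδR).ne'
  generalize √(δ : ℝ) = D at *
  have hr2 : r ^ 2 = K * D := by
    apply mul_left_cancel₀ hD0
    linear_combination D * hr / 2 + hDF / 2 + (2 - K) * hD
  refine ⟨⟨K ^ 2 * δ, ?_⟩, 1 / 2, -q / (4 * δ) / K, -t / (2 * K * δ) / (2 * K), ?_⟩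
  · push_cast
    linear_combination -(r ^ 2 + K * D) * hr2 - K ^ 2 * hD
  have hrD : D = r ^ 2 / K := by rw [hr2]; field_simp
  have hδ' : (δ : ℝ) = (α : ℝ) ^ 2 - s := by exact_mod_cast hδ
  have ht' : (t : ℝ) = 2 * α + p := by exact_mod_cast ht
  have hres' : (q : ℝ) ^ 2 = 4 * (2 * α - p) * δ := by
    rw [hδ']
    have : (q : ℝ) ^ 2 - 4 * (p - 2 * α) * (s - α ^ 2) = 0 := by exact_mod_cast hres
    linear_combination this
  have he : 2 * K * δ * (-t / (2 * K * δ)) = (-t : ℝ) := by field_simp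
  have he2 : K * (1 + (-t / (2 * K * δ)) ^ 2 * δ) = (4 : ℝ) := by
    field_simp
    linear_combination hKtR
  have key := quartic_eq_zero_of_resolvent (p := p) (q := q) (s := s) (α := α) (D := D)
    (w := -q / (4 * δ)) (y := r * (1 + -t / (2 * K * δ) * D) / 2) (hδ' ▸ hD)
    (by rw [← hδ']; field_simp)
    (by rw [← hδ']; field_simp; linear_combination hres')
    (by
      rw [← ht', div_pow, mul_pow, hr2]
      linear_combination (K * (-t / (2 * K * δ)) / 2 + K * (-t / (2 * K * δ)) ^ 2 * D / 4) * hD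
        + D / 4 * he2 + he / 4)
  have hx : ((1 / 2 : ℚ) : ℝ) * r + ((-q / (4 * δ) / K : ℚ) : ℝ) * r ^ 2
      + ((-t / (2 * K * δ) / (2 * K) : ℚ) : ℝ) * r ^ 3
      = -q / (4 * δ) * D + r * (1 + -t / (2 * K * δ) * D) / 2 := by
    rw [hrD]; push_cast; field_simp; ring
  rwa [hx]

lemma cubic_mem_adjoin_singleton (r : ℝ) (b c d : ℚ) :
    (b : ℝ) * r + c * r ^ 2 + d * r ^ 3 ∈ Algebra.adjoin ℚ ({r} : Set ℝ) := by
  have hr := Algebra.self_mem_adjoin_singleton ℚ r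
  have hq (a : ℚ) : (a : ℝ) ∈ Algebra.adjoin ℚ ({r} : Set ℝ) := algebraMap_mem _ a
  exact add_mem (add_mem (mul_mem (hq b) hr) (mul_mem (hq c) (pow_mem hr 2)))
    (mul_mem (hq d) (pow_mem hr 3))

/-- Let `p, q, s, α ∈ ℚ` with `2α > p`, `α² − s > 0`,
`q² − 4(p − 2α)(s − α²) = 0`, and suppose `Γ = 16(α² − s)² − (α² − s)(2α + p)²` is a
square of a rational. Then `16(α² − s) − (2α + p)² ≥ 0`; moreover, for the nonnegative
real `r` with `2r² = 4√(α² − s) + √(16(α² − s) − (2α + p)²)` one has `r⁴ ∈ ℚ` and the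
polynomial `x⁴ + p x² + q x + s` has a real root of the form `b r + c r² + d r³` with
`b, c, d ∈ ℚ`; in particular the polynomial is 1-solvable. -/
theorem stmt_18 (p q s α : ℚ) (hα : 2 * α > p) (hαs : α ^ 2 - s > 0)
    (hres : q ^ 2 - 4 * (p - 2 * α) * (s - α ^ 2) = 0)
    (hΓ : ∃ g : ℚ, 16 * (α ^ 2 - s) ^ 2 - (α ^ 2 - s) * (2 * α + p) ^ 2 = g ^ 2) :
    (0 ≤ 16 * (α ^ 2 - s) - (2 * α + p) ^ 2) ∧
    (∀ r : ℝ, 0 ≤ r →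
      2 * r ^ 2 = 4 * Real.sqrt ((α ^ 2 - s : ℚ))
        + Real.sqrt ((16 * (α ^ 2 - s) - (2 * α + p) ^ 2 : ℚ)) →
      IsRat (r ^ 4) ∧
      ∃ b c d : ℚ,
        ((b : ℝ) * r + c * r ^ 2 + d * r ^ 3) ^ 4
          + p * ((b : ℝ) * r + c * r ^ 2 + d * r ^ 3) ^ 2
          + q * ((b : ℝ) * r + c * r ^ 2 + d * r ^ 3) + s = 0) ∧
    (∃ (r : ℝ) (n : ℕ), 0 < n ∧ IsRat (r ^ n) ∧
      ∃ x : ℝ, x ∈ Algebra.adjoin ℚ ({r} : Set ℝ) ∧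
        x ^ 4 + p * x ^ 2 + q * x + s = 0) := by
  obtain ⟨g, hg⟩ := hΓ
  refine ⟨?_, fun r _ hr ↦ exists_root_of_radical hαs hres hg hr, ?_⟩
  · refine nonneg_of_mul_nonneg_right ?_ hαs
    calc (0 : ℚ) ≤ g ^ 2 := sq_nonneg g
      _ = _ := by rw [← hg]; ring
  · obtain ⟨h4, b, c, d, hx⟩ := exists_root_of_radical hαs hres hg
      (r := √((4 * √((α ^ 2 - s : ℚ) : ℝ)
        + √((16 * (α ^ 2 - s) - (2 * α + p) ^ 2 : ℚ) : ℝ)) / 2))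
      (by rw [Real.sq_sqrt (by positivity)]; ring)
    exact ⟨_, 4, by norm_num, h4, _, cubic_mem_adjoin_singleton _ b c d, hx⟩
end
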